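/- Let A be a split regular BiHom-Poisson superalgebra with root system Λ, and let [α] ∈ Λ/∼. Then I_{H,[α]}·H + H·I_{H,[α]} ⊆ I_{H,[α]}. -/

import Mathlib

/-- A (regular, with distinguished maximal abelian graded subalgebra `H`)
BiHom-Poisson superalgebra over a field `K`. -/
structure BHPS (K A : Type*) [Field K] [AddCommGroup A] [Module K A] where
  /-- the ℤ₂-grading -/
  grade : ZMod 2 → Submodule K A
  gradeInternal : DirectSum.IsInternal grade
  /-- the bracket -/
  br : A →ₗ[K] A →ₗ[K] A
  /-- the associative-type product -/
  mu : A →ₗ[K] A →ₗ[K] A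
  /-- the first structure map -/
  phi : A ≃ₗ[K] A
  /-- the second structure map -/
  psi : A ≃ₗ[K] A
  br_grade : ∀ (i j : ZMod 2), ∀ x ∈ grade i, ∀ y ∈ grade j, br x y ∈ grade (i + j)
  mu_grade : ∀ (i j : ZMod 2), ∀ x ∈ grade i, ∀ y ∈ grade j, mu x y ∈ grade (i + j)
  phi_grade : ∀ i, (grade i).map (phi : A →ₗ[K] A) = grade i
  psi_grade : ∀ i, (grade i).map (psi : A →ₗ[K] A) = grade i
  phi_psi_comm : ∀ x, phi (psi x) = psi (phi x)
  phi_br : ∀ x y, phi (br x y) = br (phi x) (phi y)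
  psi_br : ∀ x y, psi (br x y) = br (psi x) (psi y)
  phi_mu : ∀ x y, phi (mu x y) = mu (phi x) (phi y)
  psi_mu : ∀ x y, psi (mu x y) = mu (psi x) (psi y)
  skew : ∀ (i j : ZMod 2), ∀ x ∈ grade i, ∀ y ∈ grade j,
    br (psi x) (phi y) = -((-1 : K) ^ (i.val * j.val)) • br (psi y) (phi x)
  jacobi : ∀ (i j k : ZMod 2), ∀ x ∈ grade i, ∀ y ∈ grade j, ∀ z ∈ grade k,
    ((-1 : K) ^ (i.val * k.val)) • br (psi (psi x)) (br (psi y) (phi z))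
      + ((-1 : K) ^ (i.val * j.val)) • br (psi (psi y)) (br (psi z) (phi x))
      + ((-1 : K) ^ (j.val * k.val)) • br (psi (psi z)) (br (psi x) (phi y)) = 0
  assoc : ∀ x y z, mu (phi x) (mu y z) = mu (mu x y) (psi z)
  leibniz : ∀ (j k : ZMod 2), ∀ (x : A), ∀ y ∈ grade j, ∀ z ∈ grade k,
    br (mu x y) (phi (psi z))
      = mu (phi x) (br y (phi z)) + ((-1 : K) ^ (j.val * k.val)) • mu (br x (psi z)) (phi y)
  /-- the maximal abelian graded subalgebra -/
  H : Submodule K A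
  H_graded : H = (H ⊓ grade 0) ⊔ (H ⊓ grade 1)
  H_abelian : ∀ x ∈ H, ∀ y ∈ H, br x y = 0
  phi_H : H.map (phi : A →ₗ[K] A) = H
  psi_H : H.map (psi : A →ₗ[K] A) = H
  H_max : ∀ H' : Submodule K A, H ≤ H' →
    H' = (H' ⊓ grade 0) ⊔ (H' ⊓ grade 1) →
    (∀ x ∈ H', ∀ y ∈ H', br x y = 0) →
    H'.map (phi : A →ₗ[K] A) = H' → H'.map (psi : A →ₗ[K] A) = H' → H' = H

namespace BHPS

variable {K A : Type*} [Field K] [AddCommGroup A] [Module K A] (D : BHPS K A)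

/-- The even part `H₀` of `H`. -/
def H0 : Submodule K A := D.H ⊓ D.grade 0

lemma phi_H0 : D.H0.map (D.phi : A →ₗ[K] A) = D.H0 := by
  unfold H0
  rw [Submodule.map_inf (D.phi : A →ₗ[K] A) D.phi.injective, D.phi_H, D.phi_grade]

lemma psi_H0 : D.H0.map (D.psi : A →ₗ[K] A) = D.H0 := by
  unfold H0
  rw [Submodule.map_inf (D.psi : A →ₗ[K] A) D.psi.injective, D.psi_H, D.psi_grade]

/-- The restriction of `φ` to `H₀`, as a linear automorphism. -/
def phiH0 : ↥D.H0 ≃ₗ[K] ↥D.H0 :=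
  (D.phi.submoduleMap D.H0).trans (LinearEquiv.ofEq _ _ D.phi_H0)

/-- The restriction of `ψ` to `H₀`, as a linear automorphism. -/
def psiH0 : ↥D.H0 ≃ₗ[K] ↥D.H0 :=
  (D.psi.submoduleMap D.H0).trans (LinearEquiv.ofEq _ _ D.psi_H0)

/-- The root space attached to a linear functional `α : H₀ → K`:
`A_α = {v : [h, φ(v)] = α(h) • φψ(v) for all h ∈ H₀}`. -/
def rootSpace (α : Module.Dual K ↥D.H0) : Submodule K A where
  carrier := {v | ∀ h : ↥D.H0, D.br (h : A) (D.phi v) = α h • D.phi (D.psi v)}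
  add_mem' := by
    intro a b ha hb h
    simp only [map_add, ha h, hb h, smul_add]
  zero_mem' := by
    intro h
    simp
  smul_mem' := by
    intro c v hv h
    simp only [map_smul, hv h]
    rw [smul_comm]

/-- The root system `Λ`. -/
def roots : Set (Module.Dual K ↥D.H0) := {α | α ≠ 0 ∧ D.rootSpace α ≠ ⊥}

/-- `A` is split with respect to `H`: `A = H ⊕ (⊕_{α ∈ Λ} A_α)`. -/
def IsSplit : Prop :=
  letI := Classical.decEq (Option ↥D.roots)
  DirectSum.IsInternal (fun o : Option ↥D.roots => o.elim D.H fun α => D.rootSpace α.1)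

/-- `α ∘ φ^{z₁} ∘ ψ^{z₂}`. -/
def twist (z₁ z₂ : ℤ) (γ : Module.Dual K ↥D.H0) : Module.Dual K ↥D.H0 :=
  γ ∘ₗ ((((D.phiH0 ^ z₁) : ↥D.H0 ≃ₗ[K] ↥D.H0) : ↥D.H0 →ₗ[K] ↥D.H0) ∘ₗ
        (((D.psiH0 ^ z₂) : ↥D.H0 ≃ₗ[K] ↥D.H0) : ↥D.H0 →ₗ[K] ↥D.H0))

/-- `±S = S ∪ (-S)`. -/
def pm (S : Set (Module.Dual K ↥D.H0)) : Set (Module.Dual K ↥D.H0) :=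
  S ∪ (Neg.neg '' S)

/-- The partial sums `α₁∘φ^{-i} + α₂∘φ^{-i+1}∘ψ^{-1} + ⋯ + α_i∘φ^{-1}∘ψ^{-1} + α_{i+1}∘ψ^{-1}`
appearing in the definition of a connection. -/
def chainSum (a : ℕ → Module.Dual K ↥D.H0) (i : ℕ) : Module.Dual K ↥D.H0 :=
  D.twist (-(i : ℤ)) 0 (a 1)
    + ∑ t ∈ Finset.Icc 2 (i + 1), D.twist (-((i : ℤ) + 1 - (t : ℤ))) (-1) (a t)

/-- `a 1, …, a k` is a connection from `α` to `β` (relative to the set of roots `S`). -/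
def IsConnectionIn (S : Set (Module.Dual K ↥D.H0)) (α β : Module.Dual K ↥D.H0)
    (k : ℕ) (a : ℕ → Module.Dual K ↥D.H0) : Prop :=
  2 ≤ k ∧
  (∀ t, 1 ≤ t → t ≤ k → a t ∈ D.pm S) ∧
  (∃ n r : ℕ, a 1 = D.twist (-(n : ℤ)) (-(r : ℤ)) α) ∧
  (∀ i, 1 ≤ i → i ≤ k - 2 → D.chainSum a i ∈ D.pm S) ∧
  (∃ m s : ℕ, D.chainSum a (k - 1) = D.twist (-(m : ℤ)) (-(s : ℤ)) β
      ∨ D.chainSum a (k - 1) = -(D.twist (-(m : ℤ)) (-(s : ℤ)) β))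

/-- `α` is connected to `β` (relative to the set of roots `S`). -/
def ConnectedIn (S : Set (Module.Dual K ↥D.H0)) (α β : Module.Dual K ↥D.H0) : Prop :=
  (∃ z₁ z₂ : ℤ, ∃ ε : K, (ε = 1 ∨ ε = -1) ∧ β = ε • D.twist z₁ z₂ α) ∨
  (∃ k a, D.IsConnectionIn S α β k a)

/-- `α` is connected to `β`. -/
def Connected (α β : Module.Dual K ↥D.H0) : Prop := D.ConnectedIn D.roots α β

/-- The set `[α]` of roots connected to `α`. -/
def classSet (α : Module.Dual K ↥D.H0) : Set (Module.Dual K ↥D.H0) :=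
  {β ∈ D.roots | D.Connected α β}

/-- `I_{H,[α]} = span {[A_{β∘ψ⁻¹}, A_{−β∘φ⁻¹}] + A_{β∘ψ⁻¹}·A_{−β∘φ⁻¹} : β ∈ [α]}`. -/
def IH (α : Module.Dual K ↥D.H0) : Submodule K A :=
  ⨆ β ∈ D.classSet α,
    (Submodule.map₂ D.br (D.rootSpace (D.twist 0 (-1) β)) (D.rootSpace (-(D.twist (-1) 0 β)))
      ⊔ Submodule.map₂ D.mu (D.rootSpace (D.twist 0 (-1) β)) (D.rootSpace (-(D.twist (-1) 0 β))))

/-- `V_{[α]} = ⊕_{β ∈ [α]} A_β`. -/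
def VS (α : Module.Dual K ↥D.H0) : Submodule K A :=
  ⨆ β ∈ D.classSet α, D.rootSpace β

/-- `I_{[α]} = I_{H,[α]} ⊕ V_{[α]}`. -/
def Iclass (α : Module.Dual K ↥D.H0) : Submodule K A := D.IH α ⊔ D.VS α

/-- `J` is an ideal of the (sub)algebra `I`. -/
def IsIdealIn (J I : Submodule K A) : Prop :=
  J ≤ I ∧ J = (J ⊓ D.grade 0) ⊔ (J ⊓ D.grade 1) ∧
  Submodule.map₂ D.br J I ≤ J ∧ Submodule.map₂ D.mu J I ≤ J ∧ Submodule.map₂ D.mu I J ≤ J ∧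
  J.map (D.phi : A →ₗ[K] A) = J ∧ J.map (D.psi : A →ₗ[K] A) = J

/-- `I` is an ideal of `A`: `[I,A] + I·A + A·I ⊆ I`, graded and `φ,ψ`-invariant. -/
def IsIdeal (I : Submodule K A) : Prop := D.IsIdealIn I ⊤

/-- `A` is simple: `[A,A] + A·A ≠ 0` and its only ideals are `0` and `A`. -/
def IsSimple : Prop :=
  (Submodule.map₂ D.br ⊤ ⊤ ⊔ Submodule.map₂ D.mu (⊤ : Submodule K A) ⊤ ≠ ⊥) ∧
  ∀ I : Submodule K A, D.IsIdeal I → I = ⊥ ∨ I = ⊤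

/-- The center `Z(A) = {v : [v,A] + v·A + A·v = 0}`. -/
def center : Submodule K A where
  carrier := {v | ∀ w, D.br v w = 0 ∧ D.mu v w = 0 ∧ D.mu w v = 0}
  add_mem' := by
    intro a b ha hb w
    obtain ⟨h1, h2, h3⟩ := ha w
    obtain ⟨g1, g2, g3⟩ := hb w
    simp [map_add, LinearMap.add_apply, h1, h2, h3, g1, g2, g3]
  zero_mem' := by intro w; simp
  smul_mem' := by
    intro c v hv w
    obtain ⟨h1, h2, h3⟩ := hv w
    simp [map_smul, LinearMap.smul_apply, h1, h2, h3]

/-- `Σ_{α∈Λ} ([A_{α∘ψ⁻¹}, A_{−α∘φ⁻¹}] + A_{α∘ψ⁻¹}·A_{−α∘φ⁻¹})`. -/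
def HSum : Submodule K A :=
  ⨆ α ∈ D.roots,
    (Submodule.map₂ D.br (D.rootSpace (D.twist 0 (-1) α)) (D.rootSpace (-(D.twist (-1) 0 α)))
      ⊔ Submodule.map₂ D.mu (D.rootSpace (D.twist 0 (-1) α)) (D.rootSpace (-(D.twist (-1) 0 α))))

/-- The root system is symmetric. -/
def IsSymmetric : Prop := ∀ α ∈ D.roots, -α ∈ D.roots

/-- `A` is root multiplicative. -/
def RootMultiplicative : Prop :=
  ∀ (i j : ZMod 2) (α β : Module.Dual K ↥D.H0), α ∈ D.roots → β ∈ D.roots →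
    D.rootSpace α ⊓ D.grade i ≠ ⊥ → D.rootSpace β ⊓ D.grade j ≠ ⊥ →
    (D.twist 0 (-1) α + D.twist (-1) 0 β) ∈ D.roots →
    D.rootSpace (D.twist 0 (-1) α + D.twist (-1) 0 β) ⊓ D.grade (i + j) ≠ ⊥ →
    Submodule.map₂ D.br (D.rootSpace α ⊓ D.grade i) (D.rootSpace β ⊓ D.grade j)
      ⊔ Submodule.map₂ D.mu (D.rootSpace α ⊓ D.grade i) (D.rootSpace β ⊓ D.grade j) ≠ ⊥

/-- `A` is of maximal length: every nonzero graded root space is one-dimensional. -/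
def MaximalLength : Prop :=
  ∀ (i : ZMod 2), ∀ α ∈ D.roots, D.rootSpace α ⊓ D.grade i ≠ ⊥ →
    Module.rank K ↥(D.rootSpace α ⊓ D.grade i) = 1

end BHPS

namespace BHPS

variable {K A : Type*}

section Auxiliary

variable [Field K] [AddCommGroup A] [Module K A] (D : BHPS K A)

lemma coe_phiH0 (h : ↥D.H0) : (D.phiH0 h : A) = D.phi h := rfl

lemma coe_psiH0 (h : ↥D.H0) : (D.psiH0 h : A) = D.psi h := rfl

lemma commute_phiH0_psiH0 : Commute D.phiH0 D.psiH0 := by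
  ext h
  exact D.phi_psi_comm h

lemma twist_apply (z₁ z₂ : ℤ) (γ : Module.Dual K ↥D.H0) (h : ↥D.H0) :
    D.twist z₁ z₂ γ h = γ ((D.phiH0 ^ z₁ * D.psiH0 ^ z₂) h) := rfl

lemma twist_twist (a b c d : ℤ) (γ : Module.Dual K ↥D.H0) :
    D.twist a b (D.twist c d γ) = D.twist (a + c) (b + d) γ := by
  ext h
  have hc := (D.commute_phiH0_psiH0.zpow_zpow a d).eq
  have key : D.phiH0 ^ c * D.psiH0 ^ d * (D.phiH0 ^ a * D.psiH0 ^ b)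
      = D.phiH0 ^ (a + c) * D.psiH0 ^ (b + d) := by
    rw [mul_assoc, ← mul_assoc (D.psiH0 ^ d), ← hc, mul_assoc, ← mul_assoc, ← zpow_add,
      ← zpow_add, add_comm c, add_comm d]
  rw [twist_apply, twist_apply, twist_apply, ← key]
  rfl

lemma twist_phi (γ : Module.Dual K ↥D.H0) (h : ↥D.H0) :
    D.twist (-1) 0 γ (D.phiH0 h) = γ h := by
  have : (D.phiH0 ^ (-1 : ℤ) * D.psiH0 ^ (0 : ℤ)) * D.phiH0 = 1 := by simp
  exact congrArg γ (LinearEquiv.congr_fun this h)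

lemma twist_psi (γ : Module.Dual K ↥D.H0) (h : ↥D.H0) :
    D.twist 0 (-1) γ (D.psiH0 h) = γ h := by
  have : (D.phiH0 ^ (0 : ℤ) * D.psiH0 ^ (-1 : ℤ)) * D.psiH0 = 1 := by simp
  exact congrArg γ (LinearEquiv.congr_fun this h)

lemma twist_add (a b : ℤ) (γ δ : Module.Dual K ↥D.H0) :
    D.twist a b (γ + δ) = D.twist a b γ + D.twist a b δ := rfl

lemma twist_neg (a b : ℤ) (γ : Module.Dual K ↥D.H0) :
    D.twist a b (-γ) = -D.twist a b γ := rfl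

lemma twist_zero (a b : ℤ) : D.twist a b 0 = 0 := rfl

lemma twist_smul (a b : ℤ) (c : K) (γ : Module.Dual K ↥D.H0) :
    D.twist a b (c • γ) = c • D.twist a b γ := rfl

lemma twist_sum {ι : Type*} (a b : ℤ) (s : Finset ι) (γ : ι → Module.Dual K ↥D.H0) :
    D.twist a b (∑ t ∈ s, γ t) = ∑ t ∈ s, D.twist a b (γ t) :=
  map_sum (AddMonoidHom.mk' (D.twist a b) (D.twist_add a b)) γ s

lemma chainSum_twist (z₁ z₂ : ℤ) (a : ℕ → Module.Dual K ↥D.H0) (i : ℕ) :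
    D.chainSum (fun t => D.twist z₁ z₂ (a t)) i = D.twist z₁ z₂ (D.chainSum a i) := by
  simp only [chainSum, twist_add, twist_sum, twist_twist]
  simp only [add_comm]

variable {D}

lemma mem_rootSpace {γ : Module.Dual K ↥D.H0} {v : A} :
    v ∈ D.rootSpace γ ↔ ∀ h : ↥D.H0, D.br (h : A) (D.phi v) = γ h • D.phi (D.psi v) :=
  Iff.rfl

lemma phi_mem_rootSpace {γ : Module.Dual K ↥D.H0} {v : A} :
    D.phi v ∈ D.rootSpace (D.twist (-1) 0 γ) ↔ v ∈ D.rootSpace γ := by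
  rw [mem_rootSpace, mem_rootSpace, D.phiH0.surjective.forall]
  refine forall_congr' fun h => ?_
  rw [twist_phi, coe_phiH0, ← D.phi_br, ← D.phi_psi_comm, ← map_smul, D.phi.injective.eq_iff]

lemma psi_mem_rootSpace {γ : Module.Dual K ↥D.H0} {v : A} :
    D.psi v ∈ D.rootSpace (D.twist 0 (-1) γ) ↔ v ∈ D.rootSpace γ := by
  rw [mem_rootSpace, mem_rootSpace, D.psiH0.surjective.forall]
  refine forall_congr' fun h => ?_
  rw [twist_psi, coe_psiH0, D.phi_psi_comm, ← D.psi_br, D.phi_psi_comm, ← map_smul,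
    D.psi.injective.eq_iff, D.phi_psi_comm]

lemma apply_mem_iff_of_map_eq {e : A ≃ₗ[K] A} {P : Submodule K A}
    (h : P.map (e : A →ₗ[K] A) = P) {v : A} : e v ∈ P ↔ v ∈ P := by
  conv_lhs => rw [← h]
  exact e.injective.mem_set_image (s := (P : Set A))

lemma phi_mem_grade {i : ZMod 2} {v : A} : D.phi v ∈ D.grade i ↔ v ∈ D.grade i :=
  apply_mem_iff_of_map_eq (D.phi_grade i)

lemma psi_mem_grade {i : ZMod 2} {v : A} : D.psi v ∈ D.grade i ↔ v ∈ D.grade i :=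
  apply_mem_iff_of_map_eq (D.psi_grade i)

lemma phi_mem_H {v : A} : D.phi v ∈ D.H ↔ v ∈ D.H :=
  apply_mem_iff_of_map_eq D.phi_H

lemma psi_mem_H {v : A} : D.psi v ∈ D.H ↔ v ∈ D.H :=
  apply_mem_iff_of_map_eq D.psi_H

lemma H_le_rootSpace_zero : D.H ≤ D.rootSpace 0 := by
  intro v hv h
  rw [D.H_abelian _ h.2.1 _ (phi_mem_H.2 hv)]
  simp

lemma exists_homogeneous_add (v : A) : ∃ v₀ ∈ D.grade 0, ∃ v₁ ∈ D.grade 1, v₀ + v₁ = v := by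
  have htop := D.gradeInternal.submodule_iSup_eq_top
  have : D.grade 0 ⊔ D.grade 1 = ⊤ := by
    rw [eq_top_iff, ← htop]
    refine iSup_le fun i => ?_
    fin_cases i
    · exact le_sup_left
    · exact le_sup_right
  exact Submodule.mem_sup.1 (this ▸ Submodule.mem_top : v ∈ D.grade 0 ⊔ D.grade 1)

lemma eq_of_homogeneous_add_eq {a b c d : A} (ha : a ∈ D.grade 0) (hb : b ∈ D.grade 1)
    (hc : c ∈ D.grade 0) (hd : d ∈ D.grade 1) (h : a + b = c + d) : a = c ∧ b = d := by
  have hdis : Disjoint (D.grade 0) (D.grade 1) :=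
    D.gradeInternal.submodule_iSupIndep.pairwiseDisjoint (by decide)
  have hab : a - c = d - b := by
    rw [sub_eq_sub_iff_add_eq_add, h, add_comm]
  have h0 : a - c = 0 := Submodule.disjoint_def.1 hdis _ (sub_mem ha hc)
    (hab ▸ sub_mem hd hb)
  exact ⟨sub_eq_zero.1 h0, (sub_eq_zero.1 (hab ▸ h0)).symm⟩

/-- To prove an additive property on a root space it suffices to treat homogeneous vectors. -/
lemma rootSpace_induction {γ : Module.Dual K ↥D.H0} {p : A → Prop}
    (homog : ∀ i, ∀ v ∈ D.rootSpace γ, v ∈ D.grade i → p v)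
    (add : ∀ v w, p v → p w → p (v + w)) {v : A} (hv : v ∈ D.rootSpace γ) : p v := by
  obtain ⟨v₀, h₀, v₁, h₁, rfl⟩ := D.exists_homogeneous_add v
  have key (h : ↥D.H0) := eq_of_homogeneous_add_eq
    (a := D.br h (D.phi v₀)) (b := D.br h (D.phi v₁))
    (by simpa using D.br_grade 0 0 _ h.2.2 _ (phi_mem_grade.2 h₀))
    (by simpa using D.br_grade 0 1 _ h.2.2 _ (phi_mem_grade.2 h₁))
    (Submodule.smul_mem _ (γ h) (phi_mem_grade.2 (psi_mem_grade.2 h₀)))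
    (Submodule.smul_mem _ (γ h) (phi_mem_grade.2 (psi_mem_grade.2 h₁)))
    (by simpa only [map_add, smul_add] using hv h)
  exact add _ _ (homog 0 v₀ (fun h => (key h).1) h₀) (homog 1 v₁ (fun h => (key h).2) h₁)

lemma H_induction {p : A → Prop} (homog : ∀ i, ∀ v ∈ D.H, v ∈ D.grade i → p v)
    (add : ∀ v w, p v → p w → p (v + w)) {v : A} (hv : v ∈ D.H) : p v := by
  rw [D.H_graded] at hv
  obtain ⟨v₀, h₀, v₁, h₁, rfl⟩ := Submodule.mem_sup.1 hv
  exact add _ _ (homog 0 v₀ h₀.1 h₀.2) (homog 1 v₁ h₁.1 h₁.2)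

lemma skew_even (v : A) (h : ↥D.H0) :
    D.br (D.psi v) (D.phi h) = -D.br (D.psi h) (D.phi v) := by
  obtain ⟨v₀, h₀, v₁, h₁, rfl⟩ := D.exists_homogeneous_add v
  have e₀ := D.skew 0 0 v₀ h₀ h h.2.2
  have e₁ := D.skew 1 0 v₁ h₁ h h.2.2
  simp only [ZMod.val_zero, mul_zero, pow_zero, neg_smul, one_smul] at e₀ e₁
  simp only [map_add, LinearMap.add_apply, e₀, e₁, neg_add]

lemma mem_rootSpace_iff_br_psi {γ : Module.Dual K ↥D.H0} {v : A} :
    v ∈ D.rootSpace γ ↔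
      ∀ h : ↥D.H0, D.br (D.psi v) (D.phi h) = -(γ (D.psiH0 h)) • D.phi (D.psi v) := by
  rw [mem_rootSpace, D.psiH0.surjective.forall]
  refine forall_congr' fun h => ?_
  rw [skew_even, coe_psiH0, neg_smul, neg_inj]

lemma mu_mem_rootSpace {γ δ : Module.Dual K ↥D.H0} {x y : A} (hx : x ∈ D.rootSpace γ)
    (hy : y ∈ D.rootSpace δ) :
    D.mu x y ∈ D.rootSpace (D.twist (-1) 0 γ + D.twist 0 (-1) δ) := by
  rw [mem_rootSpace_iff_br_psi, D.psi_mu]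
  rw [mem_rootSpace_iff_br_psi] at hx hy
  intro h
  obtain ⟨h, rfl⟩ := D.psiH0.surjective h
  obtain ⟨h, rfl⟩ := D.phiH0.surjective h
  obtain ⟨y₀, h₀, y₁, h₁, hyy⟩ := D.exists_homogeneous_add (D.psi y)
  have l₀ := D.leibniz 0 0 (D.psi x) y₀ h₀ _ (D.phiH0 h).2.2
  have l₁ := D.leibniz 1 0 (D.psi x) y₁ h₁ _ (D.phiH0 h).2.2
  simp only [ZMod.val_zero, mul_zero, pow_zero, one_smul] at l₀ l₁
  have l : D.br (D.mu (D.psi x) (D.psi y)) (D.phi (D.psi (D.phiH0 h)))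
      = D.mu (D.phi (D.psi x)) (D.br (D.psi y) (D.phi (D.phiH0 h)))
        + D.mu (D.br (D.psi x) (D.psi (D.phiH0 h))) (D.phi (D.psi y)) := by
    rw [← hyy]
    simp only [map_add, LinearMap.add_apply, l₀, l₁]
    abel
  have hx' := hx (D.psiH0 h)
  have hy' := hy (D.phiH0 h)
  have hc (k : ↥D.H0) : D.psiH0 (D.phiH0 k) = D.phiH0 (D.psiH0 k) :=
    (LinearEquiv.congr_fun D.commute_phiH0_psiH0.eq k).symm
  rw [coe_psiH0, l, hy', coe_phiH0, ← D.phi_psi_comm, ← coe_psiH0, hx', LinearMap.add_apply,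
    twist_psi, D.phi_mu, hc, hc, twist_phi]
  simp only [map_smul, LinearMap.smul_apply]
  module

lemma br_mem_rootSpace {γ δ : Module.Dual K ↥D.H0} {x y : A} (hx : x ∈ D.rootSpace γ)
    (hy : y ∈ D.rootSpace δ) :
    D.br x y ∈ D.rootSpace (D.twist (-1) 0 γ + D.twist 0 (-1) δ) := by
  refine rootSpace_induction (p := fun x => D.br x y ∈ D.rootSpace _) (fun i x hx hi => ?_)
    (fun v w hv hw => by simpa using add_mem hv hw) hx
  refine rootSpace_induction (p := fun y => D.br x y ∈ D.rootSpace _) (fun j y hy hj => ?_)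
    (fun v w hv hw => by simpa using add_mem hv hw) hy
  obtain ⟨u, hu⟩ := D.psi.surjective (D.phi x)
  have hui : u ∈ D.grade i := by
    rw [← psi_mem_grade, hu, phi_mem_grade]
    exact hi
  have hur : u ∈ D.rootSpace (D.twist (-1) 1 γ) := by
    rw [← psi_mem_rootSpace, hu, twist_twist]
    exact phi_mem_rootSpace.2 hx
  intro h
  obtain ⟨h, rfl⟩ := D.psiH0.surjective h
  obtain ⟨h, rfl⟩ := D.psiH0.surjective h
  have J := D.jacobi i j 0 u hui y hj h h.2.2
  have e₁ := mem_rootSpace_iff_br_psi.1 hy h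
  have e₂ := mem_rootSpace.1 hur (D.psiH0 h)
  have e₃ := D.skew j i (D.psi y) (psi_mem_grade.2 hj) (D.psi u) (psi_mem_grade.2 hui)
  have hs : ((-1 : K) ^ (i.val * j.val)) * ((-1 : K) ^ (i.val * j.val)) = 1 := by
    rw [← mul_pow]
    simp
  have e₄ : D.twist (-1) 1 γ (D.psiH0 h) = D.twist (-1) 0 γ (D.psiH0 (D.psiH0 h)) := by
    rw [← twist_psi, twist_twist]
    rfl
  rw [coe_psiH0] at e₂
  rw [mul_comm j.val] at e₃
  rw [e₁, e₂] at J
  simp only [map_smul] at J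
  rw [e₃] at J
  simp only [ZMod.val_zero, mul_zero, pow_zero, one_smul, hu] at J
  rw [LinearMap.add_apply, twist_psi, ← e₄, coe_psiH0, coe_psiH0, D.phi_br, D.psi_br, D.phi_br,
    D.phi_psi_comm x, ← sub_eq_zero, ← J]
  generalize D.br (D.psi (D.phi x)) (D.phi (D.psi y)) = w
  rw [smul_smul, smul_smul]
  have : (-1 : K) ^ (i.val * j.val) * D.twist (-1) 1 γ (D.psiH0 h) * -(-1 : K) ^ (i.val * j.val)
      = -D.twist (-1) 1 γ (D.psiH0 h) := by
    linear_combination (-D.twist (-1) 1 γ (D.psiH0 h)) * hs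
  rw [this]
  module

lemma twist_phi_mem_roots {γ : Module.Dual K ↥D.H0} (hγ : γ ∈ D.roots) :
    D.twist (-1) 0 γ ∈ D.roots := by
  refine ⟨fun h => hγ.1 ?_, fun h => hγ.2 ?_⟩
  · ext k
    rw [← twist_phi, h]
    rfl
  · refine (Submodule.eq_bot_iff _).2 fun v hv => ?_
    rw [← phi_mem_rootSpace, h] at hv
    simpa using hv

lemma twist_psi_mem_roots {γ : Module.Dual K ↥D.H0} (hγ : γ ∈ D.roots) :
    D.twist 0 (-1) γ ∈ D.roots := by
  refine ⟨fun h => hγ.1 ?_, fun h => hγ.2 ?_⟩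
  · ext k
    rw [← twist_psi, h]
    rfl
  · refine (Submodule.eq_bot_iff _).2 fun v hv => ?_
    rw [← psi_mem_rootSpace, h] at hv
    simpa using hv

lemma Connected.twist {α β : Module.Dual K ↥D.H0} (n r : ℕ)
    (hroots : ∀ γ ∈ D.roots, D.twist (-(n : ℤ)) (-(r : ℤ)) γ ∈ D.roots)
    (h : D.Connected α β) : D.Connected α (D.twist (-(n : ℤ)) (-(r : ℤ)) β) := by
  have hpm : ∀ γ ∈ D.pm D.roots, D.twist (-(n : ℤ)) (-(r : ℤ)) γ ∈ D.pm D.roots := by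
    rintro γ (hγ | ⟨δ, hδ, rfl⟩)
    · exact Or.inl (hroots γ hγ)
    · exact Or.inr ⟨_, hroots δ hδ, rfl⟩
  rcases h with ⟨z₁, z₂, ε, hε, rfl⟩ | ⟨k, a, hk, ha, ⟨n', r', h1⟩, hc, m, s, hl⟩
  · exact Or.inl ⟨_, _, ε, hε, by rw [twist_smul, twist_twist]⟩
  · refine Or.inr ⟨k, fun t => D.twist (-(n : ℤ)) (-(r : ℤ)) (a t), hk,
      fun t h1 h2 => hpm _ (ha t h1 h2), ⟨n + n', r + r', ?_⟩, fun i h1 h2 => ?_, m, s, ?_⟩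
    · beta_reduce
      rw [h1, twist_twist]
      push_cast
      rw [neg_add, neg_add]
    · rw [chainSum_twist]
      exact hpm _ (hc i h1 h2)
    · rw [chainSum_twist, twist_twist, add_comm (-(m : ℤ)), add_comm (-(s : ℤ)), ← twist_twist]
      rcases hl with hl | hl
      · exact Or.inl (by rw [hl])
      · exact Or.inr (by rw [hl, twist_neg])

lemma Connected.neg {α β : Module.Dual K ↥D.H0} (h : D.Connected α β) : D.Connected α (-β) := by
  rcases h with ⟨z₁, z₂, ε, hε, rfl⟩ | ⟨k, a, hk, ha, h1, hc, m, s, hl⟩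
  · refine Or.inl ⟨z₁, z₂, -ε, ?_, (neg_smul _ _).symm⟩
    rcases hε with rfl | rfl <;> simp
  · refine Or.inr ⟨k, a, hk, ha, h1, hc, m, s, ?_⟩
    rw [twist_neg, neg_neg]
    exact hl.symm

variable {α β : Module.Dual K ↥D.H0}

lemma twist_phi_mem_classSet (hβ : β ∈ D.classSet α) : D.twist (-1) 0 β ∈ D.classSet α :=
  ⟨twist_phi_mem_roots hβ.1, hβ.2.twist 1 0 fun _ => twist_phi_mem_roots⟩

lemma twist_psi_mem_classSet (hβ : β ∈ D.classSet α) : D.twist 0 (-1) β ∈ D.classSet α :=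
  ⟨twist_psi_mem_roots hβ.1, hβ.2.twist 0 1 fun _ => twist_psi_mem_roots⟩

lemma neg_mem_classSet (hβ : β ∈ D.classSet α) {v : A} (hv : v ∈ D.rootSpace (-β)) (h0 : v ≠ 0) :
    -β ∈ D.classSet α :=
  ⟨⟨neg_ne_zero.2 hβ.1.1, fun h => h0 (by simpa [h] using hv)⟩, hβ.2.neg⟩

lemma br_mem_IH (hβ : β ∈ D.classSet α) {x y : A} (hx : x ∈ D.rootSpace (D.twist 0 (-1) β))
    (hy : y ∈ D.rootSpace (-(D.twist (-1) 0 β))) : D.br x y ∈ D.IH α :=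
  Submodule.mem_iSup_of_mem β <| Submodule.mem_iSup_of_mem hβ <|
    Submodule.mem_sup_left <| Submodule.apply_mem_map₂ _ hx hy

lemma mu_mem_IH (hβ : β ∈ D.classSet α) {x y : A} (hx : x ∈ D.rootSpace (D.twist 0 (-1) β))
    (hy : y ∈ D.rootSpace (-(D.twist (-1) 0 β))) : D.mu x y ∈ D.IH α :=
  Submodule.mem_iSup_of_mem β <| Submodule.mem_iSup_of_mem hβ <|
    Submodule.mem_sup_right <| Submodule.apply_mem_map₂ _ hx hy

lemma IH_le {P : Submodule K A}
    (br : ∀ β ∈ D.classSet α, ∀ x ∈ D.rootSpace (D.twist 0 (-1) β),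
      ∀ y ∈ D.rootSpace (-(D.twist (-1) 0 β)), D.br x y ∈ P)
    (mu : ∀ β ∈ D.classSet α, ∀ x ∈ D.rootSpace (D.twist 0 (-1) β),
      ∀ y ∈ D.rootSpace (-(D.twist (-1) 0 β)), D.mu x y ∈ P) : D.IH α ≤ P :=
  iSup₂_le fun β hβ => sup_le (Submodule.map₂_le.2 (br β hβ)) (Submodule.map₂_le.2 (mu β hβ))

/-- Right multiplication by `H` shifts root spaces along `φ⁻¹`. -/
lemma mu_H_mem_rootSpace {γ : Module.Dual K ↥D.H0} {x h : A} (hx : x ∈ D.rootSpace γ)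
    (hh : h ∈ D.H) : D.mu x h ∈ D.rootSpace (D.twist (-1) 0 γ) := by
  simpa [twist_zero] using mu_mem_rootSpace hx (H_le_rootSpace_zero hh)

/-- Left multiplication by `H` shifts root spaces along `ψ⁻¹`. -/
lemma H_mu_mem_rootSpace {γ : Module.Dual K ↥D.H0} {x h : A} (hh : h ∈ D.H)
    (hx : x ∈ D.rootSpace γ) : D.mu h x ∈ D.rootSpace (D.twist 0 (-1) γ) := by
  simpa [twist_zero] using mu_mem_rootSpace (H_le_rootSpace_zero hh) hx

/-- Bracketing with `H` on the left shifts root spaces along `ψ⁻¹`. -/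
lemma H_br_mem_rootSpace {γ : Module.Dual K ↥D.H0} {x h : A} (hh : h ∈ D.H)
    (hx : x ∈ D.rootSpace γ) : D.br h x ∈ D.rootSpace (D.twist 0 (-1) γ) := by
  simpa [twist_zero] using br_mem_rootSpace (H_le_rootSpace_zero hh) hx

lemma mu_mu_H_mem_IH (hβ : β ∈ D.classSet α) {x y h : A}
    (hx : x ∈ D.rootSpace (D.twist 0 (-1) β)) (hy : y ∈ D.rootSpace (-(D.twist (-1) 0 β)))
    (hh : h ∈ D.H) : D.mu (D.mu x y) h ∈ D.IH α := by
  obtain ⟨h, rfl⟩ := D.psi.surjective h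
  rw [← D.assoc]
  refine mu_mem_IH (twist_phi_mem_classSet hβ) ?_ ?_
  · simpa only [twist_twist, add_comm] using phi_mem_rootSpace.2 hx
  · exact mu_H_mem_rootSpace hy (psi_mem_H.1 hh)

lemma H_mu_mu_mem_IH (hβ : β ∈ D.classSet α) {x y h : A}
    (hx : x ∈ D.rootSpace (D.twist 0 (-1) β)) (hy : y ∈ D.rootSpace (-(D.twist (-1) 0 β)))
    (hh : h ∈ D.H) : D.mu h (D.mu x y) ∈ D.IH α := by
  obtain ⟨h, rfl⟩ := D.phi.surjective h
  rw [D.assoc]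
  refine mu_mem_IH (twist_psi_mem_classSet hβ) (H_mu_mem_rootSpace (phi_mem_H.1 hh) hx) ?_
  simpa only [twist_neg, twist_twist, add_comm] using psi_mem_rootSpace.2 hy

lemma mu_br_H_mem_IH (hβ : β ∈ D.classSet α) {x y h : A}
    (hx : x ∈ D.rootSpace (D.twist 0 (-1) β)) (hy : y ∈ D.rootSpace (-(D.twist (-1) 0 β)))
    (hh : h ∈ D.H) : D.mu (D.br x y) h ∈ D.IH α := by
  refine rootSpace_induction (p := fun y => D.mu (D.br x y) h ∈ D.IH α) (fun k y hy hk => ?_)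
    (fun v w hv hw => by simpa using add_mem hv hw) hy
  refine H_induction (p := fun h => D.mu (D.br x y) h ∈ D.IH α) (fun j h hh hj => ?_)
    (fun v w hv hw => by simpa using add_mem hv hw) hh
  obtain ⟨z, rfl⟩ := D.psi.surjective y
  obtain ⟨h, rfl⟩ := D.phi.surjective h
  have hz := phi_mem_rootSpace.2 hy
  have L := D.leibniz j k x h (phi_mem_grade.1 hj) z (psi_mem_grade.1 hk)
  have hφx : D.phi x ∈ D.rootSpace (D.twist 0 (-1) (D.twist (-1) 0 β)) := by
    simpa only [twist_twist, add_comm] using phi_mem_rootSpace.2 hx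
  have h₁ : D.br (D.mu x h) (D.phi (D.psi z)) ∈ D.IH α := by
    refine br_mem_IH (twist_phi_mem_classSet hβ) ?_ hz
    simpa only [twist_twist, add_comm] using mu_H_mem_rootSpace hx (phi_mem_H.1 hh)
  have h₂ : D.mu (D.phi x) (D.br h (D.phi z)) ∈ D.IH α := by
    refine mu_mem_IH (twist_phi_mem_classSet hβ) hφx ?_
    have hz' : D.phi z ∈ D.rootSpace (-(D.twist (-2) 1 β)) := by
      rw [← psi_mem_rootSpace, ← D.phi_psi_comm]
      simpa [twist_neg, twist_twist] using hz
    simpa [twist_neg, twist_twist] using H_br_mem_rootSpace (phi_mem_H.1 hh) hz'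
  rw [← sub_eq_iff_eq_add'] at L
  exact (Submodule.smul_mem_iff _ (pow_ne_zero _ (by simp))).1 (L ▸ sub_mem h₁ h₂)

lemma H_mu_br_mem_IH (hβ : β ∈ D.classSet α) {x y h : A}
    (hx : x ∈ D.rootSpace (D.twist 0 (-1) β)) (hy : y ∈ D.rootSpace (-(D.twist (-1) 0 β)))
    (hh : h ∈ D.H) : D.mu h (D.br x y) ∈ D.IH α := by
  refine rootSpace_induction (p := fun y => D.mu h (D.br x y) ∈ D.IH α) (fun k y hy hk => ?_)
    (fun v w hv hw => by simpa using add_mem hv hw) hy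
  refine rootSpace_induction (p := fun x => D.mu h (D.br x y) ∈ D.IH α) (fun j x hx hj => ?_)
    (fun v w hv hw => by simpa using add_mem hv hw) hx
  obtain ⟨z, rfl⟩ := D.phi.surjective y
  obtain ⟨h, rfl⟩ := D.phi.surjective h
  rw [phi_mem_H] at hh
  rw [← twist_neg, phi_mem_rootSpace] at hy
  by_cases hz : z = 0
  · simp [hz]
  have h₁ : D.br (D.mu h x) (D.phi (D.psi z)) ∈ D.IH α := by
    refine br_mem_IH (twist_psi_mem_classSet hβ) (H_mu_mem_rootSpace hh hx) ?_
    simpa only [twist_neg, twist_twist, add_comm] using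
      phi_mem_rootSpace.2 (psi_mem_rootSpace.2 hy)
  have h₂ : D.mu (D.br h (D.psi z)) (D.phi x) ∈ D.IH α := by
    refine mu_mem_IH (twist_psi_mem_classSet (neg_mem_classSet hβ hy hz))
      (H_br_mem_rootSpace hh (psi_mem_rootSpace.2 hy)) ?_
    simpa only [twist_neg, neg_neg] using phi_mem_rootSpace.2 hx
  rw [← sub_eq_iff_eq_add.2 (D.leibniz j k h x hj z (phi_mem_grade.1 hk))]
  exact sub_mem h₁ (Submodule.smul_mem _ _ h₂)

end Auxiliary

/-- `I_{H,[α]}·H + H·I_{H,[α]} ⊆ I_{H,[α]}`. -/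
theorem IH_mul_H {K A : Type*} [Field K] [AddCommGroup A] [Module K A] (D : BHPS K A)
    (hsplit : D.IsSplit)
    (α : Module.Dual K ↥D.H0) (hα : α ∈ D.roots) :
    Submodule.map₂ D.mu (D.IH α) D.H ⊔ Submodule.map₂ D.mu D.H (D.IH α) ≤ D.IH α := by
  refine sup_le (Submodule.map₂_le.2 fun v hv h hh => ?_)
    (Submodule.map₂_le.2 fun h hh v hv => ?_)
  · exact IH_le (P := (D.IH α).comap (D.mu.flip h))
      (fun β hβ x hx y hy => mu_br_H_mem_IH hβ hx hy hh)
      (fun β hβ x hx y hy => mu_mu_H_mem_IH hβ hx hy hh) hv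
  · exact IH_le (P := (D.IH α).comap (D.mu h))
      (fun β hβ x hx y hy => H_mu_br_mem_IH hβ hx hy hh)
      (fun β hβ x hx y hy => H_mu_mu_mem_IH hβ hx hy hh) hv

end BHPS
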